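/- arXiv:1501.04548 — 3 statements merged into one kernel-verified Lean document; each statement's English description precedes it below -/
import Mathlib

section
/- Let f : ℝ → ℝ be bounded and continuous. Then for every y ∈ ℝ the integral ∫_{−∞}^y (2 f(u)/σ₂(u)²)·E(u) du converges absolutely, the function G(y) = E(y)^{−1}·∫_{−∞}^y (2 f(u)/σ₂(u)²) E(u) du is well defined and continuously differentiable, and the function v(y) = ∫₀^y G(u) du is C² and satisfies the Poisson equation (m − y) v′(y) + (1/2) σ₂(y)² v″(y) = f(y) for all y ∈ ℝ. -/
open MeasureTheory

noncomputable section

/-- `E(y) = exp(∫₀^y 2(m - z)/σ₂(z)² dz)`. -/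
def Efun (m : ℝ) (σ₂ : ℝ → ℝ) (y : ℝ) : ℝ :=
  Real.exp (∫ z in (0:ℝ)..y, 2 * (m - z) / (σ₂ z) ^ 2)

/-- The normalizing constant `Z = ∫_ℝ E(y)/σ₂(y)² dy`. -/
def Zconst (m : ℝ) (σ₂ : ℝ → ℝ) : ℝ :=
  ∫ y : ℝ, Efun m σ₂ y / (σ₂ y) ^ 2

/-- The invariant measure `π` on `ℝ` with density `p(y) = Z⁻¹·E(y)/σ₂(y)²`
with respect to Lebesgue measure. -/
def pimeas (m : ℝ) (σ₂ : ℝ → ℝ) : Measure ℝ :=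
  volume.withDensity fun y => ENNReal.ofReal ((Zconst m σ₂)⁻¹ * (Efun m σ₂ y / (σ₂ y) ^ 2))

end

theorem Efun_pos (m : ℝ) (σ₂ : ℝ → ℝ) (y : ℝ) : 0 < Efun m σ₂ y := Real.exp_pos _

theorem hasDerivAt_Efun {m : ℝ} {σ₂ : ℝ → ℝ} (hσ : Continuous σ₂) (h0 : ∀ y, σ₂ y ≠ 0) (y : ℝ) :
    HasDerivAt (Efun m σ₂) (Efun m σ₂ y * (2 * (m - y) / (σ₂ y) ^ 2)) y := by
  have hb : Continuous fun z => 2 * (m - z) / (σ₂ z) ^ 2 :=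
    (by fun_prop : Continuous fun z : ℝ => 2 * (m - z)).div (hσ.pow 2) fun z => pow_ne_zero 2 (h0 z)
  exact (hb.integral_hasStrictDerivAt 0 y).hasDerivAt.exp

theorem continuous_Efun {m : ℝ} {σ₂ : ℝ → ℝ} (hσ : Continuous σ₂) (h0 : ∀ y, σ₂ y ≠ 0) :
    Continuous (Efun m σ₂) :=
  continuous_iff_continuousAt.2 fun y => (hasDerivAt_Efun hσ h0 y).continuousAt

/-- `E′ = 2(m - ·)/σ₂² E` is integrable on a left half-line, where it is nonnegative. -/
theorem integrableOn_Iic_Efun_mul_drift {m : ℝ} {σ₂ : ℝ → ℝ} (hσ : Continuous σ₂)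
    (h0 : ∀ y, σ₂ y ≠ 0) {a : ℝ} (ha : a ≤ m) :
    IntegrableOn (fun u => Efun m σ₂ u * (2 * (m - u) / (σ₂ u) ^ 2)) (Set.Iic a) := by
  have hc : Continuous fun u => Efun m σ₂ u * (2 * (m - u) / (σ₂ u) ^ 2) :=
    (continuous_Efun hσ h0).mul ((by fun_prop : Continuous fun z : ℝ => 2 * (m - z)).div
      (hσ.pow 2) fun z => pow_ne_zero 2 (h0 z))
  refine integrableOn_Iic_of_intervalIntegral_norm_bounded (l := Filter.atBot) (a := id)
    (Efun m σ₂ a) a (fun i => (hc.integrableOn_Icc).mono_set Set.Ioc_subset_Icc_self)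
    Filter.tendsto_id ?_
  filter_upwards [Filter.eventually_le_atBot a] with x hx
  have hnorm : ∫ u in x..a, ‖Efun m σ₂ u * (2 * (m - u) / (σ₂ u) ^ 2)‖
      = ∫ u in x..a, Efun m σ₂ u * (2 * (m - u) / (σ₂ u) ^ 2) := by
    refine intervalIntegral.integral_congr fun u hu => ?_
    rw [Set.uIcc_of_le hx] at hu
    have hu' : 0 ≤ m - u := by linarith [hu.2]
    exact Real.norm_of_nonneg (mul_nonneg (Efun_pos m σ₂ u).le (by positivity))
  simp only [id]
  rw [hnorm, intervalIntegral.integral_eq_sub_of_hasDerivAt (fun u _ => hasDerivAt_Efun hσ h0 u)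
    (hc.intervalIntegrable _ _)]
  linarith [Efun_pos m σ₂ x]

theorem integrableOn_Iic_mul_Efun {m : ℝ} {σ₂ : ℝ → ℝ} (hσ : Continuous σ₂)
    (h0 : ∀ y, σ₂ y ≠ 0) {f : ℝ → ℝ} (hf : Continuous f) (hfb : ∃ M, ∀ y, |f y| ≤ M) (y : ℝ) :
    IntegrableOn (fun u => 2 * f u / (σ₂ u) ^ 2 * Efun m σ₂ u) (Set.Iic y) := by
  obtain ⟨M, hM⟩ := hfb
  have hc : Continuous fun u => 2 * f u / (σ₂ u) ^ 2 * Efun m σ₂ u :=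
    ((hf.const_mul 2).div (hσ.pow 2) fun z => pow_ne_zero 2 (h0 z)).mul (continuous_Efun hσ h0)
  have hleft : IntegrableOn (fun u => 2 * f u / (σ₂ u) ^ 2 * Efun m σ₂ u) (Set.Iic (m - 1)) := by
    refine ((integrableOn_Iic_Efun_mul_drift (a := m - 1) hσ h0 (by linarith)).const_mul M).mono'
      hc.aestronglyMeasurable.restrict ?_
    refine (ae_restrict_iff' measurableSet_Iic).2 (Filter.Eventually.of_forall fun u hu => ?_)
    have hu' : 1 ≤ m - u := by linarith [Set.mem_Iic.1 hu]
    have hE := Efun_pos m σ₂ u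
    have hs : 0 < (σ₂ u) ^ 2 := by have := h0 u; positivity
    have hfu : |f u| ≤ M * (m - u) :=
      (hM u).trans (le_mul_of_one_le_right ((abs_nonneg _).trans (hM u)) hu')
    rw [Real.norm_eq_abs, abs_mul, abs_div, abs_mul, abs_two, abs_of_pos hs, abs_of_pos hE]
    calc 2 * |f u| / σ₂ u ^ 2 * Efun m σ₂ u
        ≤ 2 * (M * (m - u)) / σ₂ u ^ 2 * Efun m σ₂ u := by gcongr
      _ = M * (Efun m σ₂ u * (2 * (m - u) / σ₂ u ^ 2)) := by ring
  refine (hleft.union (hc.integrableOn_Icc (a := m - 1) (b := y))).mono_set fun u hu => ?_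
  rcases le_total u (m - 1) with h | h
  · exact Or.inl h
  · exact Or.inr ⟨h, hu⟩

theorem hasDerivAt_integral_Iic {h : ℝ → ℝ} (hc : Continuous h)
    (hi : ∀ y, IntegrableOn h (Set.Iic y)) (y : ℝ) :
    HasDerivAt (fun y => ∫ u in Set.Iic y, h u) (h y) y := by
  have heq : (fun y => ∫ u in Set.Iic y, h u)
      = fun y => (∫ u in Set.Iic (0:ℝ), h u) + ∫ u in (0:ℝ)..y, h u := by
    funext x
    rw [← intervalIntegral.integral_Iic_sub_Iic (hi 0) (hi x)]
    ring
  rw [heq]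
  exact (hc.integral_hasStrictDerivAt 0 y).hasDerivAt.const_add _

/-- for bounded continuous `f`, the integral
`∫_{-∞}^y (2f(u)/σ₂(u)²)E(u) du` converges absolutely for every `y`,
`G(y) = E(y)⁻¹ ∫_{-∞}^y (2f(u)/σ₂(u)²)E(u) du` is C¹, and
`v(y) = ∫₀^y G(u) du` is C² and solves `(m - y)v′ + (1/2)σ₂²v″ = f`. -/
theorem G_well_defined_and_solves_poisson
    (m c₂ C₂ : ℝ) (σ₂ : ℝ → ℝ) (hσ₂c : Continuous σ₂)
    (hc₂ : 0 < c₂) (hσ₂ : ∀ y, c₂ ≤ σ₂ y ∧ σ₂ y ≤ C₂)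
    (f : ℝ → ℝ) (hfc : Continuous f) (hfb : ∃ M, ∀ y, |f y| ≤ M)
    (G v : ℝ → ℝ)
    (hG : ∀ y : ℝ, G y
      = (Efun m σ₂ y)⁻¹ * ∫ u in Set.Iic y, 2 * f u / (σ₂ u) ^ 2 * Efun m σ₂ u)
    (hv : ∀ y : ℝ, v y = ∫ u in (0:ℝ)..y, G u) :
    (∀ y : ℝ, IntegrableOn (fun u => 2 * f u / (σ₂ u) ^ 2 * Efun m σ₂ u) (Set.Iic y)) ∧
    ContDiff ℝ 1 G ∧ ContDiff ℝ 2 v ∧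
    ∀ y : ℝ, (m - y) * deriv v y + (1/2) * (σ₂ y) ^ 2 * deriv (deriv v) y = f y := by
  have h0 : ∀ y, σ₂ y ≠ 0 := fun y => (hc₂.trans_le (hσ₂ y).1).ne'
  have hE0 : ∀ y, Efun m σ₂ y ≠ 0 := fun y => (Efun_pos m σ₂ y).ne'
  have hs0 : ∀ y, (σ₂ y) ^ 2 ≠ 0 := fun y => pow_ne_zero 2 (h0 y)
  have hint := integrableOn_Iic_mul_Efun (m := m) hσ₂c h0 hfc hfb
  have hc : Continuous fun u => 2 * f u / (σ₂ u) ^ 2 * Efun m σ₂ u :=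
    ((hfc.const_mul 2).div (hσ₂c.pow 2) hs0).mul (continuous_Efun hσ₂c h0)
  have hGd : ∀ y, HasDerivAt G (2 * f y / (σ₂ y) ^ 2 - 2 * (m - y) / (σ₂ y) ^ 2 * G y) y := by
    intro y
    have h := ((hasDerivAt_Efun (m := m) hσ₂c h0 y).inv (hE0 y)).mul
      (hasDerivAt_integral_Iic hc hint y)
    rw [funext hG]
    refine h.congr_deriv ?_
    have := hE0 y
    have := h0 y
    simp only [Pi.inv_apply]
    field_simp
    ring
  have hGc : Continuous G := continuous_iff_continuousAt.2 fun y => (hGd y).continuousAt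
  have hGderiv : deriv G = fun y => 2 * f y / (σ₂ y) ^ 2 - 2 * (m - y) / (σ₂ y) ^ 2 * G y :=
    funext fun y => (hGd y).deriv
  have hG1 : ContDiff ℝ 1 G := by
    refine contDiff_one_iff_deriv.2 ⟨fun y => (hGd y).differentiableAt, ?_⟩
    rw [hGderiv]
    exact ((hfc.const_mul 2).div (hσ₂c.pow 2) hs0).sub
      (((by fun_prop : Continuous fun z : ℝ => 2 * (m - z)).div (hσ₂c.pow 2) hs0).mul hGc)
  have hvd : ∀ y, HasDerivAt v (G y) y := by
    intro y
    rw [funext hv]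
    exact (hGc.integral_hasStrictDerivAt 0 y).hasDerivAt
  have hvderiv : deriv v = G := funext fun y => (hvd y).deriv
  refine ⟨hint, hG1, ?_, fun y => ?_⟩
  · rw [show (2 : WithTop ℕ∞) = 1 + 1 from one_add_one_eq_two.symm, contDiff_succ_iff_deriv]
    refine ⟨fun y => (hvd y).differentiableAt, by simp, ?_⟩
    rwa [hvderiv]
  · rw [hvderiv, hGderiv]
    have := h0 y
    field_simp
    ring
end

section
/- Let A, B ∈ ℝ and define the price correction P₁(τ, x) = τ·(−A·∂³ₓₓₓ P₀ + (A + B)·∂²ₓₓ P₀ − B·∂ₓ P₀)(τ, x), where P₀(τ, x) = P_BS(τ, x; σ̄). Then for all τ > 0 and x ∈ ℝ, P₁ has the closed form P₁(τ, x) = (K·e^{−d₂²/2}/√(2π))·(A·d₂/σ̄² + B·√τ/σ̄), where d₂ = (x − σ̄²τ/2)/(σ̄√τ). -/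
noncomputable section

/-- Standard normal cumulative distribution function
`N(z) = (1/√(2π)) ∫_{-∞}^z e^{-u²/2} du`. -/
def stdN (z : ℝ) : ℝ :=
  (Real.sqrt (2 * Real.pi))⁻¹ * ∫ u in Set.Iic z, Real.exp (-(u ^ 2) / 2)

/-- `d₁ = (x + σ²τ/2)/(σ√τ)`. -/
def d1 (σ τ x : ℝ) : ℝ := (x + σ ^ 2 * τ / 2) / (σ * Real.sqrt τ)

/-- `d₂ = (x - σ²τ/2)/(σ√τ)`. -/
def d2 (σ τ x : ℝ) : ℝ := (x - σ ^ 2 * τ / 2) / (σ * Real.sqrt τ)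

/-- Black–Scholes put price in log-moneyness variable `x = log(S/K)`,
as a function of time-to-maturity `τ`:
`P_BS(τ,x;σ) = K·N(-d₂) - K·eˣ·N(-d₁)`. -/
def PBS (K σ τ x : ℝ) : ℝ :=
  K * stdN (-(d2 σ τ x)) - K * Real.exp x * stdN (-(d1 σ τ x))

end

open MeasureTheory in
theorem hasDerivAt_stdN (z : ℝ) :
    HasDerivAt stdN ((Real.sqrt (2 * Real.pi))⁻¹ * Real.exp (-(z ^ 2) / 2)) z := by
  have hint : Integrable fun u : ℝ => Real.exp (-(u ^ 2) / 2) := by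
    refine (integrable_exp_neg_mul_sq (b := 1 / 2) (by norm_num)).congr (ae_of_all _ fun u => ?_)
    simp only
    ring_nf
  have hcont : Continuous fun u : ℝ => Real.exp (-(u ^ 2) / 2) := by fun_prop
  have hsplit : (fun z : ℝ => ∫ u in Set.Iic z, Real.exp (-(u ^ 2) / 2)) = fun z =>
      (∫ u in Set.Iic (0 : ℝ), Real.exp (-(u ^ 2) / 2)) + ∫ u in (0 : ℝ)..z,
        Real.exp (-(u ^ 2) / 2) := by
    funext z
    rw [← intervalIntegral.integral_Iic_sub_Iic hint.integrableOn hint.integrableOn]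
    ring
  have h : HasDerivAt (fun z : ℝ => ∫ u in Set.Iic z, Real.exp (-(u ^ 2) / 2))
      (Real.exp (-(z ^ 2) / 2)) z := by
    rw [hsplit]
    exact (hcont.integral_hasStrictDerivAt 0 z).hasDerivAt.const_add _
  exact h.const_mul _

theorem hasDerivAt_d1 (σ τ x : ℝ) : HasDerivAt (d1 σ τ) (σ * Real.sqrt τ)⁻¹ x := by
  exact (((hasDerivAt_id x).add_const (σ ^ 2 * τ / 2)).div_const (σ * Real.sqrt τ)).congr_deriv
    (one_div _)

theorem hasDerivAt_d2 (σ τ x : ℝ) : HasDerivAt (d2 σ τ) (σ * Real.sqrt τ)⁻¹ x := by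
  exact (((hasDerivAt_id x).sub_const (σ ^ 2 * τ / 2)).div_const (σ * Real.sqrt τ)).congr_deriv
    (one_div _)

theorem exp_mul_exp_neg_d1_sq {σ τ : ℝ} (hσ : 0 < σ) (hτ : 0 < τ) (x : ℝ) :
    Real.exp x * Real.exp (-(d1 σ τ x) ^ 2 / 2) = Real.exp (-(d2 σ τ x) ^ 2 / 2) := by
  rw [← Real.exp_add]
  congr 1
  simp only [d1, d2, div_pow, mul_pow, Real.sq_sqrt hτ.le]
  field_simp
  ring

theorem hasDerivAt_stdN_neg_d1 (σ τ x : ℝ) :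
    HasDerivAt (fun y => stdN (-(d1 σ τ y)))
      (-((Real.sqrt (2 * Real.pi))⁻¹ * Real.exp (-(d1 σ τ x) ^ 2 / 2) * (σ * Real.sqrt τ)⁻¹)) x := by
  refine ((hasDerivAt_stdN _).comp x (hasDerivAt_d1 σ τ x).neg).congr_deriv ?_
  simp only [Pi.neg_apply, neg_sq]
  ring

theorem hasDerivAt_stdN_neg_d2 (σ τ x : ℝ) :
    HasDerivAt (fun y => stdN (-(d2 σ τ y)))
      (-((Real.sqrt (2 * Real.pi))⁻¹ * Real.exp (-(d2 σ τ x) ^ 2 / 2) * (σ * Real.sqrt τ)⁻¹)) x := by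
  refine ((hasDerivAt_stdN _).comp x (hasDerivAt_d2 σ τ x).neg).congr_deriv ?_
  simp only [Pi.neg_apply, neg_sq]
  ring

theorem hasDerivAt_exp_mul_stdN_neg_d1 (K : ℝ) {σ τ : ℝ} (hσ : 0 < σ) (hτ : 0 < τ) (x : ℝ) :
    HasDerivAt (fun y => K * Real.exp y * stdN (-(d1 σ τ y)))
      (K * Real.exp x * stdN (-(d1 σ τ x)) - K * (Real.sqrt (2 * Real.pi))⁻¹ *
        (σ * Real.sqrt τ)⁻¹ * Real.exp (-(d2 σ τ x) ^ 2 / 2)) x := by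
  refine (((Real.hasDerivAt_exp x).const_mul K).mul (hasDerivAt_stdN_neg_d1 σ τ x)).congr_deriv ?_
  rw [← exp_mul_exp_neg_d1_sq hσ hτ x]
  ring

theorem hasDerivAt_exp_neg_d2_sq (σ τ x : ℝ) :
    HasDerivAt (fun y => Real.exp (-(d2 σ τ y) ^ 2 / 2))
      (-(Real.exp (-(d2 σ τ x) ^ 2 / 2) * d2 σ τ x * (σ * Real.sqrt τ)⁻¹)) x := by
  refine (((hasDerivAt_d2 σ τ x).pow 2).neg.div_const 2).exp.congr_deriv ?_
  simp only [Pi.neg_apply, Pi.pow_apply]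
  push_cast
  ring

theorem deriv_PBS (K : ℝ) {σ τ : ℝ} (hσ : 0 < σ) (hτ : 0 < τ) :
    deriv (fun y => PBS K σ τ y) = fun y => -(K * Real.exp y * stdN (-(d1 σ τ y))) := by
  funext x
  refine (((hasDerivAt_stdN_neg_d2 σ τ x).const_mul K).sub
    (hasDerivAt_exp_mul_stdN_neg_d1 K hσ hτ x)).deriv.trans ?_
  ring

theorem deriv_deriv_PBS (K : ℝ) {σ τ : ℝ} (hσ : 0 < σ) (hτ : 0 < τ) :
    deriv (deriv fun y => PBS K σ τ y) = fun y =>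
      -(K * Real.exp y * stdN (-(d1 σ τ y)) - K * (Real.sqrt (2 * Real.pi))⁻¹ *
        (σ * Real.sqrt τ)⁻¹ * Real.exp (-(d2 σ τ y) ^ 2 / 2)) := by
  rw [deriv_PBS K hσ hτ]
  exact funext fun x => (hasDerivAt_exp_mul_stdN_neg_d1 K hσ hτ x).neg.deriv

theorem deriv_deriv_deriv_PBS (K : ℝ) {σ τ : ℝ} (hσ : 0 < σ) (hτ : 0 < τ) (x : ℝ) :
    deriv (deriv (deriv fun y => PBS K σ τ y)) x =
      deriv (deriv fun y => PBS K σ τ y) x - K * (Real.sqrt (2 * Real.pi))⁻¹ *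
        (σ * Real.sqrt τ)⁻¹ ^ 2 * d2 σ τ x * Real.exp (-(d2 σ τ x) ^ 2 / 2) := by
  rw [deriv_deriv_PBS K hσ hτ]
  refine ((hasDerivAt_exp_mul_stdN_neg_d1 K hσ hτ x).sub
    ((hasDerivAt_exp_neg_d2_sq σ τ x).const_mul _)).neg.deriv.trans ?_
  ring

/-- closed form of the price correction
`P₁(τ,x) = τ(-A·∂³ₓₓₓP₀ + (A+B)·∂²ₓₓP₀ - B·∂ₓP₀)(τ,x)`, where `P₀ = P_BS(·,·;σ̄)`:
for `τ > 0`, `P₁(τ,x) = (K·e^{-d₂²/2}/√(2π))·(A·d₂/σ̄² + B·√τ/σ̄)`. -/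
theorem P1_closed_form (σb K A B : ℝ) (hσ : 0 < σb) (hK : 0 < K) :
    ∀ τ : ℝ, 0 < τ → ∀ x : ℝ,
      τ * (-A * deriv (deriv (deriv (fun x' => PBS K σb τ x'))) x
            + (A + B) * deriv (deriv (fun x' => PBS K σb τ x')) x
            - B * deriv (fun x' => PBS K σb τ x') x)
        = K * Real.exp (-(d2 σb τ x) ^ 2 / 2) / Real.sqrt (2 * Real.pi)
            * (A * d2 σb τ x / σb ^ 2 + B * Real.sqrt τ / σb) := by
  intro τ hτ x
  rw [deriv_deriv_deriv_PBS K hσ hτ, deriv_deriv_PBS K hσ hτ, deriv_PBS K hσ hτ]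
  beta_reduce
  have hs : Real.sqrt τ ≠ 0 := (Real.sqrt_pos.2 hτ).ne'
  have hp : Real.sqrt (2 * Real.pi) ≠ 0 := (Real.sqrt_pos.2 Real.two_pi_pos).ne'
  generalize Real.exp (-(d2 σb τ x) ^ 2 / 2) = E
  generalize d2 σb τ x = d
  generalize stdN _ = n
  have hτs : Real.sqrt τ ^ 2 = τ := Real.sq_sqrt hτ.le
  generalize Real.sqrt τ = s at *
  subst hτs
  field_simp
  ring
end

section
/- Let A, B ∈ ℝ and define P₁(τ, x) = τ·(−A·∂³ₓₓₓ P₀ + (A + B)·∂²ₓₓ P₀ − B·∂ₓ P₀)(τ, x), where P₀(τ, x) = P_BS(τ, x; σ̄). Then for all τ > 0 and x ∈ ℝ, the implied-volatility correction I₁(τ, x) = P₁(τ, x)·(K·√τ·e^{−d₂²/2}/√(2π))^{−1} (i.e. P₁ divided by the Black–Scholes vega at volatility σ̄) equals A·x/(σ̄³·τ) + (B − A/2)/σ̄, where d₂ = (x − σ̄²τ/2)/(σ̄√τ). In particular I₁ is an affine function of the log-moneyness-to-maturity ratio x/τ. -/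
/-- The standard normal density. -/
noncomputable def stdNDensity (z : ℝ) : ℝ :=
  Real.exp (-(z ^ 2) / 2) / Real.sqrt (2 * Real.pi)

theorem integrable_exp_neg_sq_div_two :
    MeasureTheory.Integrable (fun u : ℝ => Real.exp (-(u ^ 2) / 2)) := by
  refine (integrable_exp_neg_mul_sq (b := 1 / 2) (by norm_num)).congr (.of_forall fun u => ?_)
  ring_nf

theorem hasDerivAt_stdN_s12 (z : ℝ) : HasDerivAt stdN (stdNDensity z) z := by
  have hcont : Continuous fun u : ℝ => Real.exp (-(u ^ 2) / 2) := by fun_prop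
  have hsplit : stdN = fun w => (Real.sqrt (2 * Real.pi))⁻¹ *
      ((∫ u in Set.Iic (0 : ℝ), Real.exp (-(u ^ 2) / 2)) +
        ∫ u in (0 : ℝ)..w, Real.exp (-(u ^ 2) / 2)) := by
    funext w
    rw [stdN, ← intervalIntegral.integral_Iic_sub_Iic
      integrable_exp_neg_sq_div_two.integrableOn integrable_exp_neg_sq_div_two.integrableOn,
      add_sub_cancel]
  rw [hsplit]
  refine (((hcont.integral_hasStrictDerivAt 0 z).hasDerivAt.const_add _).const_mul _).congr_deriv ?_
  exact (div_eq_inv_mul _ _).symm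

theorem hasDerivAt_stdNDensity (z : ℝ) :
    HasDerivAt stdNDensity (-z * stdNDensity z) z := by
  have h := ((((hasDerivAt_id z).pow 2).neg.div_const 2).exp).div_const (Real.sqrt (2 * Real.pi))
  refine h.congr_deriv ?_
  simp only [stdNDensity, id, Pi.neg_apply, Pi.pow_apply]
  push_cast
  ring

theorem stdNDensity_neg (z : ℝ) : stdNDensity (-z) = stdNDensity z := by
  simp [stdNDensity]

theorem exp_mul_stdNDensity_d1 {σ τ : ℝ} (hσ : 0 < σ) (hτ : 0 < τ) (x : ℝ) :
    Real.exp x * stdNDensity (d1 σ τ x) = stdNDensity (d2 σ τ x) := by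
  rw [stdNDensity, stdNDensity, ← mul_div_assoc, ← Real.exp_add]
  congr 2
  rw [d1, d2, div_pow, div_pow, mul_pow, Real.sq_sqrt hτ.le]
  field_simp
  ring

/-- The first derivative of the put price in the log-moneyness. -/
theorem hasDerivAt_PBS (K : ℝ) {σ τ : ℝ} (hσ : 0 < σ) (hτ : 0 < τ) (x : ℝ) :
    HasDerivAt (fun y => PBS K σ τ y) (-(K * Real.exp x * stdN (-(d1 σ τ x)))) x := by
  have h₂ := ((hasDerivAt_stdN_s12 _).comp x (hasDerivAt_d2 σ τ x).neg).const_mul K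
  have h₁ := ((Real.hasDerivAt_exp x).const_mul K).mul
    ((hasDerivAt_stdN_s12 _).comp x (hasDerivAt_d1 σ τ x).neg)
  refine (h₂.sub h₁).congr_deriv ?_
  simp only [Function.comp_apply, Pi.neg_apply, stdNDensity_neg]
  linear_combination K * (σ * Real.sqrt τ)⁻¹ * exp_mul_stdNDensity_d1 hσ hτ x

/-- The second derivative of the put price in the log-moneyness. -/
theorem hasDerivAt_deriv_PBS (K : ℝ) {σ τ : ℝ} (hσ : 0 < σ) (hτ : 0 < τ) (x : ℝ) :
    HasDerivAt (fun y => -(K * Real.exp y * stdN (-(d1 σ τ y))))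
      (-(K * Real.exp x * stdN (-(d1 σ τ x))) +
        K * (σ * Real.sqrt τ)⁻¹ * stdNDensity (d2 σ τ x)) x := by
  have h₁ := ((Real.hasDerivAt_exp x).const_mul K).mul
    ((hasDerivAt_stdN_s12 _).comp x (hasDerivAt_d1 σ τ x).neg)
  refine h₁.neg.congr_deriv ?_
  simp only [Function.comp_apply, Pi.neg_apply, stdNDensity_neg]
  linear_combination K * (σ * Real.sqrt τ)⁻¹ * exp_mul_stdNDensity_d1 hσ hτ x

/-- The third derivative of the put price in the log-moneyness. -/
theorem hasDerivAt_deriv_deriv_PBS (K : ℝ) {σ τ : ℝ} (hσ : 0 < σ) (hτ : 0 < τ) (x : ℝ) :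
    HasDerivAt (fun y => -(K * Real.exp y * stdN (-(d1 σ τ y))) +
        K * (σ * Real.sqrt τ)⁻¹ * stdNDensity (d2 σ τ y))
      (-(K * Real.exp x * stdN (-(d1 σ τ x))) +
        K * (σ * Real.sqrt τ)⁻¹ * stdNDensity (d2 σ τ x) -
        K * (σ * Real.sqrt τ)⁻¹ ^ 2 * d2 σ τ x * stdNDensity (d2 σ τ x)) x := by
  have h := ((hasDerivAt_stdNDensity _).comp x (hasDerivAt_d2 σ τ x)).const_mul
    (K * (σ * Real.sqrt τ)⁻¹)
  refine ((hasDerivAt_deriv_PBS K hσ hτ x).add h).congr_deriv ?_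
  ring

/-- The implied-volatility correction, in closed form. -/
theorem impliedVolCorrection_eq {σ K : ℝ} (A B : ℝ) (hσ : 0 < σ) (hK : 0 < K)
    {τ : ℝ} (hτ : 0 < τ) (x : ℝ) :
    (τ * (-A * deriv (deriv (deriv (fun x' => PBS K σ τ x'))) x
          + (A + B) * deriv (deriv (fun x' => PBS K σ τ x')) x
          - B * deriv (fun x' => PBS K σ τ x') x))
        * (K * Real.sqrt τ * Real.exp (-(d2 σ τ x) ^ 2 / 2) / Real.sqrt (2 * Real.pi))⁻¹
      = A * x / (σ ^ 3 * τ) + (B - A / 2) / σ := by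
  have hd := funext fun y => (hasDerivAt_PBS K hσ hτ y).deriv
  have hdd := funext fun y => (hasDerivAt_deriv_PBS K hσ hτ y).deriv
  have hvega : K * Real.sqrt τ * Real.exp (-(d2 σ τ x) ^ 2 / 2) / Real.sqrt (2 * Real.pi)
      = K * Real.sqrt τ * stdNDensity (d2 σ τ x) := by
    rw [stdNDensity, mul_div_assoc]
  have hφ : 0 < stdNDensity (d2 σ τ x) := by
    unfold stdNDensity
    positivity
  rw [hvega, hd, hdd, (hasDerivAt_deriv_deriv_PBS K hσ hτ x).deriv]
  beta_reduce
  have hs : 0 < Real.sqrt τ := Real.sqrt_pos.mpr hτ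
  have hd2 : d2 σ τ x = (x - σ ^ 2 * τ / 2) / (σ * Real.sqrt τ) := rfl
  generalize stdNDensity (d2 σ τ x) = p at hφ ⊢
  rw [hd2]
  generalize stdN (-(d1 σ τ x)) = n
  obtain ⟨s, hs_eq⟩ : ∃ s, s = Real.sqrt τ := ⟨_, rfl⟩
  have hτs : τ = s ^ 2 := by rw [hs_eq, Real.sq_sqrt hτ.le]
  rw [← hs_eq] at hs ⊢
  rw [hτs]
  field_simp
  ring


/-- the implied volatility correction `I₁ = P₁ / vega` equals
`A·x/(σ̄³τ) + (B - A/2)/σ̄`; in particular it is an affine function of the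
log-moneyness-to-maturity ratio `x/τ`. -/
theorem I1_LMMR_affine (σb K A B : ℝ) (hσ : 0 < σb) (hK : 0 < K) :
    (∀ τ : ℝ, 0 < τ → ∀ x : ℝ,
      (τ * (-A * deriv (deriv (deriv (fun x' => PBS K σb τ x'))) x
            + (A + B) * deriv (deriv (fun x' => PBS K σb τ x')) x
            - B * deriv (fun x' => PBS K σb τ x') x))
          * (K * Real.sqrt τ * Real.exp (-(d2 σb τ x) ^ 2 / 2) / Real.sqrt (2 * Real.pi))⁻¹
        = A * x / (σb ^ 3 * τ) + (B - A / 2) / σb) ∧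
    ∃ a d : ℝ, ∀ τ : ℝ, 0 < τ → ∀ x : ℝ,
      (τ * (-A * deriv (deriv (deriv (fun x' => PBS K σb τ x'))) x
            + (A + B) * deriv (deriv (fun x' => PBS K σb τ x')) x
            - B * deriv (fun x' => PBS K σb τ x') x))
          * (K * Real.sqrt τ * Real.exp (-(d2 σb τ x) ^ 2 / 2) / Real.sqrt (2 * Real.pi))⁻¹
        = a * (x / τ) + d := by
  refine ⟨fun τ hτ x => impliedVolCorrection_eq A B hσ hK hτ x,
    A / σb ^ 3, (B - A / 2) / σb, fun τ hτ x => ?_⟩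
  rw [impliedVolCorrection_eq A B hσ hK hτ x, div_mul_div_comm]
end
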